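/- Let f₁, f₂, … be multipliers of the Dirichlet space 𝒟 with column operator norm ‖M_F^C‖ ≤ 1. Then for every h ∈ 𝒟, ∫_𝔻 (∑_{j=1}^∞ |f_j′(z)|²) |h(z)|² dA(z) ≤ 4 ‖h‖_𝒟². -/

import Mathlib

open Metric MeasureTheory Complex

/-- Taylor coefficient at 0. -/
noncomputable def dirCoeff (f : ℂ → ℂ) (n : ℕ) : ℂ :=
  iteratedDeriv n f 0 / (n.factorial : ℂ)

/-- Membership in the Dirichlet space. -/
def MemDirichlet (f : ℂ → ℂ) : Prop :=
  DifferentiableOn ℂ f (ball (0:ℂ) 1) ∧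
  Summable (fun n : ℕ => ((n : ℝ) + 1) * ‖dirCoeff f n‖ ^ 2)

/-- Squared Dirichlet norm. -/
noncomputable def dirNormSq (f : ℂ → ℂ) : ℝ :=
  ∑' n : ℕ, ((n : ℝ) + 1) * ‖dirCoeff f n‖ ^ 2

/-- Multiplier of the Dirichlet space. -/
def IsMultiplier (φ : ℂ → ℂ) : Prop :=
  DifferentiableOn ℂ φ (ball (0:ℂ) 1) ∧
  ∀ f, MemDirichlet f → MemDirichlet (fun z => φ z * f z)

/-- Operator norm of the multiplication operator. -/
noncomputable def multNorm (φ : ℂ → ℂ) : ℝ :=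
  sInf {C : ℝ | 0 ≤ C ∧ ∀ f, MemDirichlet f →
    dirNormSq (fun z => φ z * f z) ≤ C ^ 2 * dirNormSq f}

/-- The column operator of `F` has norm at most `C`. -/
def ColNormLE (F : ℕ → ℂ → ℂ) (C : ℝ) : Prop :=
  ∀ h, MemDirichlet h →
    Summable (fun j : ℕ => dirNormSq (fun z => F j z * h z)) ∧
    (∑' j : ℕ, dirNormSq (fun z => F j z * h z)) ≤ C ^ 2 * dirNormSq h

open Filter Topology
open scoped ComplexConjugate ENNReal

lemma integral_unitBall_pow_mul_conj_pow {n m : ℕ} (hnm : n ≠ m) :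
    ∫ z in ball (0:ℂ) 1, z ^ n * conj z ^ m = 0 := by
  set ω : Circle := Circle.exp 1 with hω
  set I := ∫ z in ball (0:ℂ) 1, z ^ n * conj z ^ m with hI
  have hrot : I = ((ω:ℂ) ^ n * conj (ω:ℂ) ^ m) * I := by
    have h1 := (LinearIsometryEquiv.measurePreserving (rotation ω)).setIntegral_preimage_emb
      (rotation ω).toHomeomorph.measurableEmbedding (fun z : ℂ => z ^ n * conj z ^ m) (ball 0 1)
    have h2 : (rotation ω) ⁻¹' ball (0:ℂ) 1 = ball 0 1 := by
      ext z
      rw [Set.mem_preimage, mem_ball_zero_iff, LinearIsometryEquiv.norm_map, mem_ball_zero_iff]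
    rw [h2] at h1
    rw [hI]
    nth_rewrite 1 [← h1]
    rw [← integral_const_mul]
    congr 1
    ext z
    simp only [rotation_apply, map_mul, mul_pow]
    ring
  have hne : (ω:ℂ) ^ n * conj (ω:ℂ) ^ m ≠ 1 := by
    intro h
    have hc : (ω:ℂ) * conj (ω:ℂ) = 1 := by
      rw [Complex.mul_conj, Circle.normSq_coe]; simp
    have h3 : (ω:ℂ) ^ n = (ω:ℂ) ^ m := by
      calc (ω:ℂ) ^ n = (ω:ℂ) ^ n * ((ω:ℂ) * conj (ω:ℂ)) ^ m := by rw [hc]; simp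
        _ = (ω:ℂ) ^ n * conj (ω:ℂ) ^ m * (ω:ℂ) ^ m := by rw [mul_pow]; ring
        _ = (ω:ℂ) ^ m := by rw [h, one_mul]
    rw [hω, Circle.coe_exp, ← Complex.exp_nat_mul, ← Complex.exp_nat_mul,
      Complex.exp_eq_exp_iff_exists_int] at h3
    obtain ⟨k, hk⟩ := h3
    have hk2 : (n : ℝ) = m + k * (2 * Real.pi) := by
      have := congrArg Complex.im hk
      simpa using this
    have hk0 : (k : ℝ) ≠ 0 := by
      intro h0
      rw [h0] at hk2
      apply hnm
      have : (n:ℝ) = m := by linarith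
      exact_mod_cast this
    apply (irrational_pi.ne_rat (((n:ℚ) - m) / (2 * k)))
    push_cast
    field_simp
    linarith
  have : (1 - (ω:ℂ) ^ n * conj (ω:ℂ) ^ m) * I = 0 := by
    rw [sub_mul, one_mul, ← hrot, sub_self]
  exact (mul_eq_zero.mp this).resolve_left (sub_ne_zero.mpr hne.symm)

lemma integral_unitBall_norm_pow (n : ℕ) :
    ∫ z in ball (0:ℂ) 1, ‖z‖ ^ (2 * n) = Real.pi / (n + 1) := by
  have h1 : ∫ z in ball (0:ℂ) 1, ‖z‖ ^ (2 * n)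
      = ∫ z : ℂ, (Set.Iio (1:ℝ)).indicator (fun y => y ^ (2 * n)) ‖z‖ := by
    rw [← integral_indicator measurableSet_ball]
    congr 1
    ext z
    by_cases hz : ‖z‖ < 1 <;> simp [Set.indicator, hz]
  rw [h1, integral_fun_norm_addHaar]
  have h2 : ∫ y in Set.Ioi (0:ℝ), y ^ (Module.finrank ℝ ℂ - 1) •
      (Set.Iio (1:ℝ)).indicator (fun y => y ^ (2 * n)) y = 1 / (2 * n + 2) := by
    have h3 : ∀ y : ℝ, y ^ (Module.finrank ℝ ℂ - 1) •
        (Set.Iio (1:ℝ)).indicator (fun y => y ^ (2 * n)) y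
        = (Set.Iio (1:ℝ)).indicator (fun y => y ^ (2 * n + 1)) y := by
      intro y
      by_cases hy : y < 1 <;> simp [hy, Complex.finrank_real_complex, pow_succ']
    simp_rw [h3]
    rw [setIntegral_indicator measurableSet_Iio, Set.Ioi_inter_Iio,
      ← integral_Ioc_eq_integral_Ioo, ← intervalIntegral.integral_of_le zero_le_one,
      integral_pow]
    simp
    ring
  rw [h2]
  simp [Complex.finrank_real_complex, Measure.real, Complex.volume_ball]
  field_simp

lemma integral_unitBall_normSq_sum (b : ℕ → ℂ) (N : ℕ) :
    ∫ z in ball (0:ℂ) 1, ‖∑ n ∈ Finset.range N, b n * z ^ n‖ ^ 2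
      = Real.pi * ∑ n ∈ Finset.range N, ‖b n‖ ^ 2 / (n + 1) := by
  have hint : ∀ n m : ℕ, IntegrableOn
      (fun z : ℂ => b n * conj (b m) * (z ^ n * conj z ^ m)) (ball (0:ℂ) 1) := by
    intro n m
    refine ((Continuous.continuousOn (by fun_prop)).integrableOn_compact
      (isCompact_closedBall (0:ℂ) 1)).mono_set ball_subset_closedBall
  have hd : ∀ n : ℕ, ∫ z in ball (0:ℂ) 1, z ^ n * conj z ^ n = ((Real.pi / (n + 1) : ℝ) : ℂ) := by
    intro n
    rw [← integral_unitBall_norm_pow, ← integral_complex_ofReal]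
    congr 1
    ext z
    rw [← mul_pow, Complex.mul_conj, Complex.normSq_eq_norm_sq, pow_mul]
    push_cast
    rfl
  apply Complex.ofReal_injective
  rw [← integral_complex_ofReal]
  have h1 : ∀ z : ℂ, ((‖∑ n ∈ Finset.range N, b n * z ^ n‖ ^ 2 : ℝ) : ℂ)
      = ∑ n ∈ Finset.range N, ∑ m ∈ Finset.range N, b n * conj (b m) * (z ^ n * conj z ^ m) := by
    intro z
    rw [← Complex.normSq_eq_norm_sq, ← Complex.mul_conj, map_sum, Finset.sum_mul_sum]
    refine Finset.sum_congr rfl fun n _ => Finset.sum_congr rfl fun m _ => ?_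
    simp only [map_mul, map_pow]
    ring
  simp_rw [h1]
  rw [integral_finsetSum _ fun n _ => integrable_finsetSum _ fun m _ => hint n m]
  rw [Finset.mul_sum]
  push_cast
  refine Finset.sum_congr rfl fun n hn => ?_
  rw [integral_finsetSum _ fun m _ => hint n m, Finset.sum_eq_single n]
  · rw [integral_const_mul, hd, Complex.mul_conj, Complex.normSq_eq_norm_sq]
    push_cast
    ring
  · intro m _ hm
    rw [integral_const_mul, integral_unitBall_pow_mul_conj_pow hm.symm, mul_zero]
  · intro h; exact absurd hn h

lemma hasSum_dirCoeff {f : ℂ → ℂ} (hf : DifferentiableOn ℂ f (ball 0 1)) {z : ℂ}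
    (hz : z ∈ ball (0:ℂ) 1) : HasSum (fun n => dirCoeff f n * z ^ n) (f z) := by
  have := Complex.hasSum_taylorSeries_on_ball hf hz
  refine this.congr_fun ?_
  intro n
  simp only [dirCoeff, sub_zero, smul_eq_mul]
  ring

lemma dirCoeff_deriv (f : ℂ → ℂ) (n : ℕ) :
    dirCoeff (deriv f) n = (n + 1) * dirCoeff f (n + 1) := by
  have : (n.factorial : ℂ) ≠ 0 := mod_cast n.factorial_ne_zero
  have : (n + 1 : ℂ) ≠ 0 := mod_cast n.succ_ne_zero
  simp only [dirCoeff, iteratedDeriv_succ', Nat.factorial_succ]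
  push_cast
  field_simp

/-- The Dirichlet integral is at most `π` times the squared Dirichlet norm. -/
lemma lintegral_deriv_sq_le {f : ℂ → ℂ} (hf : MemDirichlet f) :
    ∫⁻ z in ball (0:ℂ) 1, ‖deriv f z‖ₑ ^ 2 ≤ ENNReal.ofReal (Real.pi * dirNormSq f) := by
  have hd : DifferentiableOn ℂ (deriv f) (ball 0 1) := hf.1.deriv isOpen_ball
  set p : ℕ → ℂ → ℂ := fun N z => ∑ n ∈ Finset.range N, dirCoeff (deriv f) n * z ^ n with hp
  have hpc : ∀ N, Continuous (p N) := fun N => by fun_prop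
  have hlim : ∀ z ∈ ball (0:ℂ) 1, ‖deriv f z‖ₑ ^ 2 = liminf (fun N => ‖p N z‖ₑ ^ 2) atTop := by
    intro z hz
    have h := (hasSum_dirCoeff hd hz).tendsto_sum_nat
    exact ((ENNReal.continuous_pow 2).tendsto _ |>.comp h.enorm).liminf_eq.symm
  have hbound : ∀ N, ∫⁻ z in ball (0:ℂ) 1, ‖p N z‖ₑ ^ 2
      ≤ ENNReal.ofReal (Real.pi * dirNormSq f) := by
    intro N
    have hi : IntegrableOn (fun z => ‖p N z‖ ^ 2) (ball (0:ℂ) 1) :=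
      ((Continuous.continuousOn (by fun_prop)).integrableOn_compact
        (isCompact_closedBall (0:ℂ) 1)).mono_set ball_subset_closedBall
    have h1 : ∫⁻ z in ball (0:ℂ) 1, ‖p N z‖ₑ ^ 2
        = ENNReal.ofReal (∫ z in ball (0:ℂ) 1, ‖p N z‖ ^ 2) := by
      rw [ofReal_integral_eq_lintegral_ofReal hi (ae_of_all _ fun z => by positivity)]
      congr 1
      ext z
      rw [ENNReal.ofReal_pow (norm_nonneg _), ofReal_norm]
    rw [h1, hp, integral_unitBall_normSq_sum]
    refine ENNReal.ofReal_le_ofReal (mul_le_mul_of_nonneg_left ?_ Real.pi_pos.le)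
    calc ∑ n ∈ Finset.range N, ‖dirCoeff (deriv f) n‖ ^ 2 / (n + 1)
        = ∑ n ∈ Finset.range N, ((n:ℝ) + 1) * ‖dirCoeff f (n + 1)‖ ^ 2 := by
          refine Finset.sum_congr rfl fun n _ => ?_
          have hn : ‖(n + 1 : ℂ)‖ = n + 1 := by
            rw [← Nat.cast_add_one, Complex.norm_natCast]; push_cast; rfl
          rw [dirCoeff_deriv, norm_mul, hn]
          field_simp
      _ ≤ ∑ n ∈ Finset.range N, (((n + 1 : ℕ) : ℝ) + 1) * ‖dirCoeff f (n + 1)‖ ^ 2 := by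
          refine Finset.sum_le_sum fun n _ => ?_
          push_cast
          gcongr
          linarith
      _ ≤ ∑ n ∈ Finset.range (N + 1), ((n : ℝ) + 1) * ‖dirCoeff f n‖ ^ 2 := by
          rw [Finset.sum_range_succ' _ N]
          exact le_add_of_nonneg_right (by positivity)
      _ ≤ dirNormSq f := hf.2.sum_le_tsum _ fun n _ => by positivity
  calc ∫⁻ z in ball (0:ℂ) 1, ‖deriv f z‖ₑ ^ 2
      = ∫⁻ z in ball (0:ℂ) 1, liminf (fun N => ‖p N z‖ₑ ^ 2) atTop :=
        setLIntegral_congr_fun measurableSet_ball hlim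
    _ ≤ liminf (fun N => ∫⁻ z in ball (0:ℂ) 1, ‖p N z‖ₑ ^ 2) atTop :=
        lintegral_liminf_le fun N => ((hpc N).measurable.enorm.pow_const 2)
    _ ≤ ENNReal.ofReal (Real.pi * dirNormSq f) :=
        liminf_le_of_frequently_le' (Frequently.of_forall hbound)

lemma summable_norm_pow_div {w : ℂ} (hw : w ∈ ball (0:ℂ) 1) :
    Summable fun n : ℕ => ‖w‖ ^ (2 * n) / ((n:ℝ) + 1) := by
  have hw' : ‖w‖ < 1 := by simpa using hw
  refine Summable.of_nonneg_of_le (fun n => by positivity) (fun n => ?_)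
    (summable_geometric_of_lt_one (sq_nonneg ‖w‖) (by nlinarith [norm_nonneg w]))
  rw [pow_mul]
  exact div_le_self (by positivity) (by linarith [(Nat.cast_nonneg n : (0:ℝ) ≤ n)])

/-- Point evaluations are bounded on the Dirichlet space. -/
lemma norm_sq_le_dirNormSq_mul {f : ℂ → ℂ} (hf : MemDirichlet f) {w : ℂ}
    (hw : w ∈ ball (0:ℂ) 1) :
    ‖f w‖ ^ 2 ≤ dirNormSq f * ∑' n : ℕ, ‖w‖ ^ (2 * n) / ((n:ℝ) + 1) := by
  refine le_of_tendsto ((hasSum_dirCoeff hf.1 hw).tendsto_sum_nat.norm.pow 2)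
    (Eventually.of_forall fun N => ?_)
  calc ‖∑ n ∈ Finset.range N, dirCoeff f n * w ^ n‖ ^ 2
      ≤ (∑ n ∈ Finset.range N, ‖dirCoeff f n * w ^ n‖) ^ 2 := by
        gcongr; exact norm_sum_le _ _
    _ ≤ (∑ n ∈ Finset.range N, ((n:ℝ) + 1) * ‖dirCoeff f n‖ ^ 2) *
          ∑ n ∈ Finset.range N, ‖w‖ ^ (2 * n) / ((n:ℝ) + 1) := by
        refine Finset.sum_sq_le_sum_mul_sum_of_sq_le_mul _ (fun n _ => by positivity)
          (fun n _ => by positivity) fun n _ => ?_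
        rw [norm_mul, norm_pow]
        refine le_of_eq ?_
        field_simp
        ring
    _ ≤ _ := by
        refine mul_le_mul (hf.2.sum_le_tsum _ fun n _ => by positivity)
          ((summable_norm_pow_div hw).sum_le_tsum _ fun n _ => by positivity)
          (Finset.sum_nonneg fun n _ => by positivity) (tsum_nonneg fun n => by positivity)

/-- The power series with bounded coefficients `c` is analytic on the unit disk and has
Taylor coefficients `c`. -/
lemma differentiableOn_and_dirCoeff_tsum {c : ℕ → ℂ} (hc : ∀ n, ‖c n‖ ≤ 1) :
    DifferentiableOn ℂ (fun z => ∑' n, c n * z ^ n) (ball 0 1) ∧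
      ∀ n, dirCoeff (fun z => ∑' n, c n * z ^ n) n = c n := by
  set p := FormalMultilinearSeries.ofScalars ℂ c
  have hr : 1 ≤ p.radius := by
    refine p.le_radius_of_bound 1 (r := 1) fun n => ?_
    simpa [p, FormalMultilinearSeries.ofScalars_norm] using hc n
  have hs : p.sum = fun z => ∑' n, c n * z ^ n := by
    ext z
    simp [p, FormalMultilinearSeries.sum, mul_comm]
  have hb : HasFPowerSeriesOnBall (fun z => ∑' n, c n * z ^ n) p 0 1 := by
    rw [← hs]
    exact (p.hasFPowerSeriesOnBall (lt_of_lt_of_le one_pos hr)).mono one_pos hr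
  refine ⟨?_, fun n => ?_⟩
  · have := hb.differentiableOn
    rwa [← ENNReal.ofReal_one, Metric.eball_ofReal] at this
  · have h1 := hb.factorial_smul 1 n
    rw [iteratedFDeriv_apply_eq_iteratedDeriv_mul_prod, Finset.prod_const_one, one_smul] at h1
    rw [dirCoeff, ← h1]
    have : (n.factorial : ℂ) ≠ 0 := mod_cast n.factorial_ne_zero
    simp [p]
    field_simp

/-- A column multiplier of norm at most `1` is pointwise bounded by `1`. -/
lemma tsum_enorm_sq_le_one {F : ℕ → ℂ → ℂ} (hF : ∀ j, IsMultiplier (F j)) (hcol : ColNormLE F 1)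
    {w : ℂ} (hw : w ∈ ball (0:ℂ) 1) : ∑' j, ‖F j w‖ₑ ^ 2 ≤ 1 := by
  have hw' : ‖w‖ < 1 := by simpa using hw
  set c : ℕ → ℂ := fun n => conj w ^ n / (n + 1) with hc
  have hn : ∀ n : ℕ, ‖(n + 1 : ℂ)‖ = n + 1 := fun n => by
    rw [← Nat.cast_add_one, Complex.norm_natCast]; push_cast; rfl
  have hcn : ∀ n, ‖c n‖ = ‖w‖ ^ n / (n + 1) := fun n => by
    rw [hc]; simp only [norm_div, norm_pow, RCLike.norm_conj, hn]
  have hc1 : ∀ n, ‖c n‖ ≤ 1 := fun n => by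
    rw [hcn]
    refine div_le_one_of_le₀ ?_ (by positivity)
    linarith [pow_le_one₀ (n := n) (norm_nonneg w) hw'.le, (Nat.cast_nonneg n : (0:ℝ) ≤ n)]
  obtain ⟨hd, hcoef⟩ := differentiableOn_and_dirCoeff_tsum hc1
  set k : ℂ → ℂ := fun z => ∑' n, c n * z ^ n with hk
  set K : ℝ := ∑' n : ℕ, ‖w‖ ^ (2 * n) / ((n:ℝ) + 1) with hK
  have hterm : ∀ n : ℕ, ((n:ℝ) + 1) * ‖dirCoeff k n‖ ^ 2 = ‖w‖ ^ (2 * n) / ((n:ℝ) + 1) := by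
    intro n
    rw [hcoef, hcn]
    field_simp
    ring
  have hkm : MemDirichlet k := ⟨hd, by simpa only [hterm] using summable_norm_pow_div hw⟩
  have hkn : dirNormSq k = K := by simp only [dirNormSq, hterm, hK]
  have hkw : k w = (K : ℂ) := by
    rw [hk, hK, Complex.ofReal_tsum]
    refine tsum_congr fun n => ?_
    rw [hc]
    push_cast
    rw [pow_mul, ← Complex.ofReal_pow, ← Complex.normSq_eq_norm_sq, ← Complex.mul_conj, mul_pow]
    ring
  have hKpos : 0 < K :=
    (summable_norm_pow_div hw).tsum_pos (fun n => by positivity) 0 (by simp)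
  obtain ⟨hsum, hle⟩ := hcol k hkm
  have hj : ∀ j, ‖F j w‖ ^ 2 ≤ dirNormSq (fun z => F j z * k z) / K := by
    intro j
    have h := norm_sq_le_dirNormSq_mul ((hF j).2 k hkm) hw
    rw [norm_mul, hkw, Complex.norm_real, Real.norm_of_nonneg hKpos.le] at h
    rw [le_div_iff₀ hKpos]
    refine le_of_mul_le_mul_right ?_ hKpos
    calc _ = (‖F j w‖ * K) ^ 2 := by ring
      _ ≤ _ := h
  calc ∑' j, ‖F j w‖ₑ ^ 2
      ≤ ∑' j, ENNReal.ofReal (dirNormSq (fun z => F j z * k z) / K) := by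
        refine ENNReal.tsum_le_tsum fun j => ?_
        rw [← ofReal_norm, ← ENNReal.ofReal_pow (norm_nonneg _)]
        exact ENNReal.ofReal_le_ofReal (hj j)
    _ = ENNReal.ofReal (∑' j, dirNormSq (fun z => F j z * k z) / K) :=
        (ENNReal.ofReal_tsum_of_nonneg (fun j => (sq_nonneg _).trans (hj j))
          (hsum.div_const K)).symm
    _ ≤ ENNReal.ofReal 1 := by
        refine ENNReal.ofReal_le_ofReal ?_
        rw [tsum_div_const, div_le_one hKpos]
        simpa [hkn] using hle
    _ = 1 := ENNReal.ofReal_one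

lemma dirNormSq_nonneg (f : ℂ → ℂ) : 0 ≤ dirNormSq f := tsum_nonneg fun n => by positivity

lemma enorm_sub_sq_le (a b : ℂ) : ‖a - b‖ₑ ^ 2 ≤ 2 * ‖a‖ₑ ^ 2 + 2 * ‖b‖ₑ ^ 2 := by
  have h : ‖a - b‖ ^ 2 ≤ 2 * ‖a‖ ^ 2 + 2 * ‖b‖ ^ 2 := by
    have := norm_sub_le a b
    nlinarith [norm_nonneg (a - b), sq_nonneg (‖a‖ - ‖b‖)]
  have h2 := ENNReal.ofReal_le_ofReal h
  rw [ENNReal.ofReal_add (by positivity) (by positivity), ENNReal.ofReal_mul zero_le_two,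
    ENNReal.ofReal_mul zero_le_two] at h2
  simpa [ENNReal.ofReal_pow, ofReal_norm] using h2

lemma ENNReal.ofReal_tsum_le {u : ℕ → ℝ} (hu : ∀ j, 0 ≤ u j) :
    ENNReal.ofReal (∑' j, u j) ≤ ∑' j, ENNReal.ofReal (u j) := by
  by_cases hs : Summable u
  · rw [ENNReal.ofReal_tsum_of_nonneg hu hs]
  · simp [tsum_eq_zero_of_not_summable hs]

lemma lintegral_tsum_deriv_sq_mul_le {F : ℕ → ℂ → ℂ} (hF : ∀ j, IsMultiplier (F j))
    (hcol : ColNormLE F 1) {h : ℂ → ℂ} (hh : MemDirichlet h) :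
    ∫⁻ z in ball (0:ℂ) 1, ∑' j, ‖deriv (F j) z * h z‖ₑ ^ 2
      ≤ ENNReal.ofReal (4 * Real.pi * dirNormSq h) := by
  have hpt : ∀ z ∈ ball (0:ℂ) 1, ∑' j, ‖deriv (F j) z * h z‖ₑ ^ 2
      ≤ (∑' j, 2 * ‖deriv (fun z => F j z * h z) z‖ₑ ^ 2) + 2 * ‖deriv h z‖ₑ ^ 2 := by
    intro z hz
    have hnhds := isOpen_ball.mem_nhds hz
    calc ∑' j, ‖deriv (F j) z * h z‖ₑ ^ 2
        ≤ ∑' j, (2 * ‖deriv (fun z => F j z * h z) z‖ₑ ^ 2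
            + 2 * (‖F j z‖ₑ ^ 2 * ‖deriv h z‖ₑ ^ 2)) := by
          refine ENNReal.tsum_le_tsum fun j => ?_
          have hd := deriv_fun_mul ((hF j).1.differentiableAt hnhds) (hh.1.differentiableAt hnhds)
          have he : deriv (F j) z * h z = deriv (fun z => F j z * h z) z - F j z * deriv h z := by
            rw [hd]; ring
          rw [he, ← mul_pow, ← enorm_mul]
          exact enorm_sub_sq_le _ _
      _ = (∑' j, 2 * ‖deriv (fun z => F j z * h z) z‖ₑ ^ 2)
            + 2 * ((∑' j, ‖F j z‖ₑ ^ 2) * ‖deriv h z‖ₑ ^ 2) := by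
          rw [ENNReal.tsum_add, ENNReal.tsum_mul_left (a := 2) (f := fun j =>
            ‖F j z‖ₑ ^ 2 * ‖deriv h z‖ₑ ^ 2), ENNReal.tsum_mul_right]
      _ ≤ _ := by
          gcongr
          exact mul_le_of_le_one_left' (tsum_enorm_sq_le_one hF hcol hz)
  have hmeas : ∀ f : ℂ → ℂ, Measurable fun z => 2 * ‖deriv f z‖ₑ ^ 2 := fun f =>
    ((measurable_deriv f).enorm.pow_const 2).const_mul 2
  obtain ⟨hsum, hle⟩ := hcol h hh
  have hmain : ∀ f : ℂ → ℂ, MemDirichlet f → ∫⁻ z in ball (0:ℂ) 1, 2 * ‖deriv f z‖ₑ ^ 2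
      ≤ ENNReal.ofReal (2 * Real.pi * dirNormSq f) := by
    intro f hf
    rw [lintegral_const_mul _ ((measurable_deriv f).enorm.pow_const 2), mul_assoc,
      ENNReal.ofReal_mul zero_le_two, ENNReal.ofReal_ofNat]
    gcongr
    exact lintegral_deriv_sq_le hf
  have hpi : 0 ≤ 2 * Real.pi := by positivity
  calc ∫⁻ z in ball (0:ℂ) 1, ∑' j, ‖deriv (F j) z * h z‖ₑ ^ 2
      ≤ ∫⁻ z in ball (0:ℂ) 1,
          ((∑' j, 2 * ‖deriv (fun z => F j z * h z) z‖ₑ ^ 2) + 2 * ‖deriv h z‖ₑ ^ 2) :=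
        setLIntegral_mono' measurableSet_ball hpt
    _ = (∑' j, ∫⁻ z in ball (0:ℂ) 1, 2 * ‖deriv (fun z => F j z * h z) z‖ₑ ^ 2)
          + ∫⁻ z in ball (0:ℂ) 1, 2 * ‖deriv h z‖ₑ ^ 2 := by
        rw [lintegral_add_right _ (hmeas h), lintegral_tsum fun j => (hmeas _).aemeasurable]
    _ ≤ (∑' j, ENNReal.ofReal (2 * Real.pi * dirNormSq (fun z => F j z * h z)))
          + ENNReal.ofReal (2 * Real.pi * dirNormSq h) := by
        gcongr with j
        · exact hmain _ ((hF j).2 h hh)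
        · exact hmain h hh
    _ = ENNReal.ofReal (2 * Real.pi * ∑' j, dirNormSq (fun z => F j z * h z))
          + ENNReal.ofReal (2 * Real.pi * dirNormSq h) := by
        rw [← tsum_mul_left, ENNReal.ofReal_tsum_of_nonneg
          (fun j => mul_nonneg hpi (dirNormSq_nonneg _)) (hsum.mul_left _)]
    _ ≤ ENNReal.ofReal (2 * Real.pi * dirNormSq h) + ENNReal.ofReal (2 * Real.pi * dirNormSq h) := by
        gcongr
        simpa using hle
    _ = ENNReal.ofReal (4 * Real.pi * dirNormSq h) := by
        have := mul_nonneg hpi (dirNormSq_nonneg h)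
        rw [← ENNReal.ofReal_add this this]
        congr 1
        ring

/-- If `‖M_F^C‖ ≤ 1` then `∫_𝔻 (∑ⱼ |fⱼ'|²)|h|² dA ≤ 4 ‖h‖²_𝒟`
(with `dA` normalized by `π`). -/
theorem Fprime_h_estimate
    (F : ℕ → ℂ → ℂ) (hF : ∀ j, IsMultiplier (F j)) (hcol : ColNormLE F 1)
    (h : ℂ → ℂ) (hh : MemDirichlet h) :
    (1 / Real.pi) * (∫ z in ball (0:ℂ) 1,
        (∑' j : ℕ, ‖deriv (F j) z‖ ^ 2) * ‖h z‖ ^ 2)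
      ≤ 4 * dirNormSq h := by
  have hnn := dirNormSq_nonneg h
  have key : (∫ z in ball (0:ℂ) 1, (∑' j : ℕ, ‖deriv (F j) z‖ ^ 2) * ‖h z‖ ^ 2)
      ≤ 4 * Real.pi * dirNormSq h := by
    by_cases hi : IntegrableOn
        (fun z => (∑' j : ℕ, ‖deriv (F j) z‖ ^ 2) * ‖h z‖ ^ 2) (ball (0:ℂ) 1)
    · rw [integral_eq_lintegral_of_nonneg_ae
        (ae_of_all _ fun z => mul_nonneg (tsum_nonneg fun j => by positivity) (by positivity))
        hi.aestronglyMeasurable]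
      refine ENNReal.toReal_le_of_le_ofReal (by positivity)
        (le_trans (lintegral_mono fun z => ?_) (lintegral_tsum_deriv_sq_mul_le hF hcol hh))
      simp only [← tsum_mul_right]
      refine (ENNReal.ofReal_tsum_le fun j => by positivity).trans_eq (tsum_congr fun j => ?_)
      rw [← mul_pow, ← norm_mul, ENNReal.ofReal_pow (norm_nonneg _), ofReal_norm]
    · rw [integral_undef hi]
      positivity
  rw [one_div_mul_eq_div, div_le_iff₀ Real.pi_pos]
  linarith
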